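/- Let X be a random vector in ℝ^d with a pdf, and for each D > 0 set ε = (D/κ)^{1/r} for a fixed κ > 0. Then limsup_{D↓0} sup_q ∑_i P(X ∈ B_{i,ε}) · Λ_{i,ε}^{r/d} / D ≤ V_d^{r/d} · (1 + r/d), where the supremum is over all quantizers q with quantization regions S_i and reconstruction values x̂_i satisfying E[‖X − q(X)‖^r] ≤ D, B_{i,ε} = { x ∈ S_i : ‖x − x̂_i‖ ≤ ε }, and Λ_{i,ε} is the Lebesgue measure of B_{i,ε}. -/

import Mathlib

open MeasureTheory Filter Set
open scoped ENNReal Topology ProbabilityTheory Pointwise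

noncomputable section

/-- `N` is a norm on `ℝ^d`. -/
structure IsNorm {d : ℕ} (N : (Fin d → ℝ) → ℝ) : Prop where
  nonneg : ∀ x, 0 ≤ N x
  eq_zero_iff : ∀ x, N x = 0 ↔ x = 0
  smul : ∀ (c : ℝ) (x : Fin d → ℝ), N (c • x) = |c| * N x
  triangle : ∀ x y, N (x + y) ≤ N x + N y

/-- Lebesgue volume `V_d` of the unit ball of the norm `N`. -/
def unitBallVol {d : ℕ} (N : (Fin d → ℝ) → ℝ) : ℝ :=
  (volume {x : Fin d → ℝ | N x ≤ 1}).toReal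

/-- A (symbol-wise) quantizer: countably many disjoint Borel quantization regions `S i`
covering the space, with reconstruction values `c i`. -/
structure Quantizer (E : Type*) [MeasurableSpace E] where
  S : ℤ → Set E
  c : ℤ → E
  meas : ∀ i, MeasurableSet (S i)
  disj : Pairwise (Function.onFun Disjoint S)
  cover : ⋃ i, S i = Set.univ

/-- Expected `r`-th power distortion `E[‖X - q(X)‖^r]` of a quantizer, for a source with law `μ`
and norm `N`. -/
def Quantizer.distortion {E : Type*} [MeasurableSpace E] [Sub E] (q : Quantizer E)
    (μ : Measure E) (N : E → ℝ) (r : ℝ) : ℝ≥0∞ :=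
  ∑' i, ∫⁻ x in q.S i, ENNReal.ofReal (N (x - q.c i) ^ r) ∂μ

/-- Output entropy `H(q(X)) = -∑ pᵢ log pᵢ` of a quantizer (as an extended nonneg. real). -/
def Quantizer.entropy {E : Type*} [MeasurableSpace E] (q : Quantizer E) (μ : Measure E) : ℝ≥0∞ :=
  ∑' i, ENNReal.ofReal (Real.negMulLog (μ (q.S i)).toReal)

/-- Output entropy `H(q(X)) = -∑ pᵢ log pᵢ` of a quantizer (as a real number). -/
def Quantizer.entropyR {E : Type*} [MeasurableSpace E] (q : Quantizer E) (μ : Measure E) : ℝ :=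
  ∑' i, Real.negMulLog (μ (q.S i)).toReal

open scoped Classical in
/-- Kullback-Leibler divergence between two measures. -/
def klDiv {α : Type*} [MeasurableSpace α] (μ ν : Measure α) : ℝ≥0∞ :=
  if μ ≪ ν ∧ Integrable (fun x => Real.log (μ.rnDeriv ν x).toReal) μ
  then ENNReal.ofReal (∫ x, Real.log (μ.rnDeriv ν x).toReal ∂μ)
  else ⊤

/-- Mutual information of a joint law `π`, i.e. the KL divergence of `π` from the product of
its marginals. -/
def mutualInfo {α β : Type*} [MeasurableSpace α] [MeasurableSpace β]
    (π : Measure (α × β)) : ℝ≥0∞ :=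
  klDiv π ((π.map Prod.fst).prod (π.map Prod.snd))

/-- The rate-distortion function `R(D)`: the infimum of the mutual information `I(X; X̂)` over
all Markov kernels `P_{X̂|X}` with expected `r`-th power distortion at most `D`. -/
def RDfun {E : Type*} [MeasurableSpace E] [Sub E] (μ : Measure E) (N : E → ℝ) (r D : ℝ) :
    ℝ≥0∞ :=
  ⨅ (κ : ProbabilityTheory.Kernel E E) (_ : ProbabilityTheory.IsMarkovKernel κ)
    (_ : ∫⁻ p, ENNReal.ofReal (N (p.1 - p.2) ^ r) ∂(μ.compProd κ) ≤ ENNReal.ofReal D),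
    mutualInfo (μ.compProd κ)

/-- The smallest output entropy `R_{r,d}(D)` of a quantizer with `r`-th power distortion
at most `D`. -/
def RQfun {E : Type*} [MeasurableSpace E] [Sub E] (μ : Measure E) (N : E → ℝ) (r D : ℝ) :
    ℝ≥0∞ :=
  ⨅ (q : Quantizer E) (_ : q.distortion μ N r ≤ ENNReal.ofReal D), q.entropy μ

/-- The asymptotic excess rate `ℛ = liminf_{D ↓ 0} (R_{r,d}(D) - R(D))`. -/
def excessRate {E : Type*} [MeasurableSpace E] [Sub E] (μ : Measure E) (N : E → ℝ) (r : ℝ) :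
    ℝ :=
  Filter.liminf (fun D => (RQfun μ N r D).toReal - (RDfun μ N r D).toReal) (𝓝[>] (0:ℝ))

/-- The upper incomplete Gamma function `Γ(s, a) = ∫_a^∞ ξ^(s-1) e^(-ξ) dξ`. -/
def uGamma (s a : ℝ) : ℝ := ∫ ξ in Set.Ioi a, ξ ^ (s - 1) * Real.exp (-ξ)

/-- The part of the quantization cell `S i` within distance `ε` of the reconstruction point. -/
def Bcell {E : Type*} [MeasurableSpace E] [Sub E] (q : Quantizer E) (N : E → ℝ) (ε : ℝ)
    (i : ℤ) : Set E :=
  {x | x ∈ q.S i ∧ N (x - q.c i) ≤ ε}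

namespace IsNorm

variable {d : ℕ} {N : (Fin d → ℝ) → ℝ}

lemma map_sub_rev (hN : IsNorm N) (x y : Fin d → ℝ) : N (x - y) = N (y - x) := by
  have h := hN.smul (-1) (y - x)
  simpa using h

lemma exists_le_mul_norm (hN : IsNorm N) : ∃ C : ℝ, 0 < C ∧ ∀ x, N x ≤ C * ‖x‖ := by
  have hsum : ∀ (s : Finset (Fin d)) (g : Fin d → Fin d → ℝ),
      N (∑ i ∈ s, g i) ≤ ∑ i ∈ s, N (g i) := fun s g ↦
    Finset.le_sum_of_subadditive N ((hN.eq_zero_iff 0).2 rfl).le hN.triangle s g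
  refine ⟨1 + ∑ i, N (Pi.single i 1), ?_, fun x ↦ ?_⟩
  · have : 0 ≤ ∑ i, N (Pi.single i 1) := Finset.sum_nonneg fun i _ ↦ hN.nonneg _
    linarith
  · calc N x = N (∑ i, x i • Pi.single i (1 : ℝ)) := by
          congr 1
          exact pi_eq_sum_univ' x
      _ ≤ ∑ i, N (x i • Pi.single i (1 : ℝ)) := hsum _ _
      _ = ∑ i, |x i| * N (Pi.single i 1) := by simp_rw [hN.smul]
      _ ≤ ∑ i, ‖x‖ * N (Pi.single i 1) := by
          gcongr with i
          · exact hN.nonneg _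
          · exact norm_le_pi_norm x i
      _ ≤ (1 + ∑ i, N (Pi.single i 1)) * ‖x‖ := by
          rw [← Finset.mul_sum]
          nlinarith [norm_nonneg x]

lemma continuous (hN : IsNorm N) : Continuous N := by
  obtain ⟨C, -, h⟩ := hN.exists_le_mul_norm
  refine (LipschitzWith.of_dist_le' (K := C) fun x y ↦ ?_).continuous
  rw [Real.dist_eq, dist_eq_norm, abs_sub_le_iff]
  have h₁ := hN.triangle (x - y) y
  have h₂ := hN.triangle (y - x) x
  rw [sub_add_cancel] at h₁ h₂
  have h₃ := h (x - y)
  rw [hN.map_sub_rev y x] at h₂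
  constructor <;> linarith

lemma exists_norm_le_mul (hN : IsNorm N) : ∃ C : ℝ, 0 < C ∧ ∀ x, ‖x‖ ≤ C * N x := by
  obtain ⟨a, ha, h⟩ := (isCompact_sphere (0 : Fin d → ℝ) 1).exists_forall_le'
    hN.continuous.continuousOn (a := 0) fun x hx ↦ by
      refine (hN.nonneg x).lt_of_ne' fun h0 ↦ ?_
      rw [(hN.eq_zero_iff x).1 h0] at hx
      simp at hx
  refine ⟨a⁻¹, inv_pos.2 ha, fun x ↦ ?_⟩
  rcases eq_or_ne x 0 with rfl | hx
  · simpa using mul_nonneg (inv_pos.2 ha).le (hN.nonneg 0)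
  · have hx' := norm_pos_iff.2 hx
    have := h (‖x‖⁻¹ • x) (by simp [norm_smul, hx'.ne'])
    rw [hN.smul, abs_inv, abs_norm] at this
    field_simp at this ⊢
    linarith

lemma volume_unitBall_ne_top (hN : IsNorm N) : volume {x | N x ≤ 1} ≠ ∞ := by
  obtain ⟨C, hC, h⟩ := hN.exists_norm_le_mul
  refine ((measure_mono fun x hx ↦ ?_).trans_lt
    (measure_closedBall_lt_top (μ := volume) (x := (0 : Fin d → ℝ)) (r := C))).ne
  rw [mem_closedBall_zero_iff]
  exact (h x).trans (mul_le_of_le_one_right hC.le hx)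

lemma unitBallVol_pos (hN : IsNorm N) : 0 < unitBallVol N := by
  refine ENNReal.toReal_pos ?_ hN.volume_unitBall_ne_top
  have ho : IsOpen {x | N x < 1} := isOpen_lt hN.continuous continuous_const
  have h0 : (0 : Fin d → ℝ) ∈ {x | N x < 1} := by
    simp [(hN.eq_zero_iff 0).2 rfl]
  exact ((ho.measure_pos volume ⟨0, h0⟩).trans_le
    (measure_mono fun x (hx : N x < 1) ↦ hx.le)).ne'

lemma volume_ball (hN : IsNorm N) (c : Fin d → ℝ) {t : ℝ} (ht : 0 < t) :
    volume {x | N (x - c) ≤ t} = ENNReal.ofReal (unitBallVol N * t ^ d) := by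
  have h : {x | N (x - c) ≤ t} = (fun x ↦ x - c) ⁻¹' (t • {x | N x ≤ 1}) := by
    ext x
    rw [mem_preimage, mem_smul_set_iff_inv_smul_mem₀ ht.ne', mem_ofPred_eq, mem_ofPred_eq, hN.smul,
      abs_of_pos (inv_pos.2 ht), inv_mul_le_iff₀ ht, mul_one]
  have hmp := (measurePreserving_sub_right volume c).measure_preimage
    ((isClosed_le hN.continuous continuous_const).measurableSet.const_smul₀ t).nullMeasurableSet
    (s := t • {x | N x ≤ 1})
  rw [h, hmp, Measure.addHaar_smul, Module.finrank_fin_fun, abs_of_nonneg (by positivity), mul_comm,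
    ENNReal.ofReal_mul hN.unitBallVol_pos.le, unitBallVol,
    ENNReal.ofReal_toReal hN.volume_unitBall_ne_top]

/-- Among all sets of given volume, balls have the smallest `r`-th moment. -/
lemma volume_mul_rpow_le_lintegral (hN : IsNorm N) (hd : 0 < d) {r : ℝ} (hr : 0 < r)
    (c : Fin d → ℝ) {B : Set (Fin d → ℝ)} (hB : volume B ≠ ∞) :
    volume B * ENNReal.ofReal ((volume B).toReal ^ (r / d)) ≤
      ENNReal.ofReal (unitBallVol N ^ (r / (d : ℝ)) * (1 + r / d)) *
        ∫⁻ x in B, ENNReal.ofReal (N (x - c) ^ r) := by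
  have hd' : (0 : ℝ) < d := by exact_mod_cast hd
  have hV := hN.unitBallVol_pos
  set V := unitBallVol N with hVdef
  set Λ := (volume B).toReal with hΛ
  have hΛ0 : 0 ≤ Λ := ENNReal.toReal_nonneg
  set p := r / (d : ℝ) with hp
  have hp0 : 0 < p := div_pos hr hd'
  set T := (Λ / V) ^ p with hT
  have hT0 : 0 ≤ T := by positivity
  have hTp : T ^ p⁻¹ = Λ / V := by
    rw [hT, ← Real.rpow_mul (by positivity), mul_inv_cancel₀ hp0.ne', Real.rpow_one]
  have hVT : V ^ p * T = Λ ^ p := by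
    rw [hT, Real.div_rpow hΛ0 hV.le]
    field_simp
  have hpowint : IntervalIntegrable (fun t : ℝ ↦ V * t ^ p⁻¹) volume 0 T :=
    (continuous_const.mul
      (Real.continuous_rpow_const (by positivity))).intervalIntegrable _ _
  have hint : IntervalIntegrable (fun t : ℝ ↦ Λ - V * t ^ p⁻¹) volume 0 T :=
    intervalIntegrable_const.sub hpowint
  have hnonneg : ∀ t ∈ Ioc 0 T, 0 ≤ Λ - V * t ^ p⁻¹ := fun t ht ↦ by
    have : t ^ p⁻¹ ≤ T ^ p⁻¹ := Real.rpow_le_rpow ht.1.le ht.2 (by positivity)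
    rw [hTp, le_div_iff₀ hV] at this
    linarith
  have hval : ∫ t in (0 : ℝ)..T, (Λ - V * t ^ p⁻¹) = Λ * T / (1 + p) := by
    have h1 : (-1 : ℝ) < p⁻¹ := by linarith [inv_pos.2 hp0]
    rw [intervalIntegral.integral_sub intervalIntegrable_const hpowint,
      intervalIntegral.integral_const_mul, integral_rpow (Or.inl h1),
      Real.zero_rpow (by positivity), Real.rpow_add_one' hT0 (by positivity), hTp]
    simp only [intervalIntegral.integral_const, smul_eq_mul]
    field_simp
    ring
  have hlow : ENNReal.ofReal (Λ * T / (1 + p)) ≤ ∫⁻ x in B, ENNReal.ofReal (N (x - c) ^ r) := by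
    have hmeas : Measurable fun x ↦ N (x - c) ^ r :=
      (hN.continuous.measurable.comp (measurable_id.sub_const c)).pow_const r
    rw [lintegral_eq_lintegral_meas_le _ (ae_of_all _ fun x ↦ Real.rpow_nonneg (hN.nonneg _) r)
      hmeas.aemeasurable, ← hval, intervalIntegral.integral_of_le hT0,
      ofReal_integral_eq_lintegral_ofReal hint.1
        ((ae_restrict_iff' measurableSet_Ioc).2 (ae_of_all _ hnonneg))]
    refine (setLIntegral_mono' measurableSet_Ioc fun t ht ↦ ?_).trans
      (lintegral_mono_set Ioc_subset_Ioi_self)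
    have hs : MeasurableSet {x | t ≤ N (x - c) ^ r} := measurableSet_le measurable_const hmeas
    have hcover : B ⊆ ({x | t ≤ N (x - c) ^ r} ∩ B) ∪ {x | N (x - c) ≤ t ^ r⁻¹} := by
      intro x hx
      rcases le_total t (N (x - c) ^ r) with h | h
      · exact Or.inl ⟨h, hx⟩
      · refine Or.inr ?_
        rw [mem_ofPred_eq]
        exact (Real.le_rpow_inv_iff_of_pos (hN.nonneg _) ht.1.le hr).2 h
    have hle := (measure_mono hcover).trans (measure_union_le (μ := volume) _ _)
    rw [hN.volume_ball c (Real.rpow_pos_of_pos ht.1 _), ← Measure.restrict_apply hs] at hle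
    have hpow : (t ^ r⁻¹) ^ d = t ^ p⁻¹ := by
      rw [← Real.rpow_natCast, ← Real.rpow_mul ht.1.le, hp, inv_div, inv_mul_eq_div]
    rw [hpow] at hle
    rw [ENNReal.ofReal_sub _ (mul_nonneg hV.le (Real.rpow_nonneg ht.1.le _)), hΛ,
      ENNReal.ofReal_toReal hB]
    exact tsub_le_iff_right.2 hle
  calc volume B * ENNReal.ofReal (Λ ^ p) = ENNReal.ofReal (Λ * Λ ^ p) := by
        rw [ENNReal.ofReal_mul hΛ0, hΛ, ENNReal.ofReal_toReal hB]
    _ = ENNReal.ofReal (V ^ p * (1 + p)) * ENNReal.ofReal (Λ * T / (1 + p)) := by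
        rw [← ENNReal.ofReal_mul (by positivity), ← hVT]
        congr 1
        field_simp
    _ ≤ _ := by gcongr

/-- A function integrable on `ℝ^d` is uniformly well approximated in `L¹` by functions which are
constant on each of countably many disjoint cells of small diameter. -/
lemma exists_tsum_lintegral_sub_le (hN : IsNorm N) {f : (Fin d → ℝ) → ℝ}
    (hf : Integrable f volume) {δ : ℝ} (hδ : 0 < δ) :
    ∃ ε₀ : ℝ, 0 < ε₀ ∧ ∃ a : (Fin d → ℝ) → ℝ,
      ∀ (B : ℤ → Set (Fin d → ℝ)) (c : ℤ → Fin d → ℝ), (∀ i, MeasurableSet (B i)) →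
        Pairwise (Function.onFun Disjoint B) → (∀ i, ∀ x ∈ B i, N (x - c i) ≤ ε₀) →
        ∑' i, ∫⁻ x in B i, ENNReal.ofReal |f x - a (c i)| ≤ ENNReal.ofReal δ := by
  obtain ⟨g, hgs, hgf, hgc, hgi⟩ := hf.exists_hasCompactSupport_lintegral_sub_le
    (ε := ENNReal.ofReal (δ / 2)) (by simpa using hδ)
  obtain ⟨C, hC, hCN⟩ := hN.exists_norm_le_mul
  set K := Metric.cthickening 1 (tsupport g) with hK
  have hKc : IsCompact K := IsCompact.cthickening hgs
  have hKfin : volume K ≠ ∞ := hKc.measure_lt_top.ne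
  set v := (volume K).toReal with hv
  have hv0 : 0 ≤ v := ENNReal.toReal_nonneg
  set η := δ / (2 * (v + 1)) with hη
  have hη0 : 0 < η := by positivity
  obtain ⟨ρ, hρ, hρg⟩ := Metric.uniformContinuous_iff.1
    (hgs.uniformContinuous_of_continuous hgc) η hη0
  refine ⟨min 1 (ρ / 2) / C, by positivity, g, ?_⟩
  intro B c hBm hBd hBc
  set h : (Fin d → ℝ) → ℝ≥0∞ := fun x ↦ ‖f x - g x‖ₑ + K.indicator (fun _ ↦ ENNReal.ofReal η) x
    with hh
  have hpt : ∀ i, ∀ x ∈ B i, ENNReal.ofReal |f x - g (c i)| ≤ h x := by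
    intro i x hx
    have hdist : dist x (c i) ≤ min 1 (ρ / 2) := by
      rw [dist_eq_norm]
      refine (hCN _).trans ?_
      have := hBc i x hx
      rwa [le_div_iff₀ hC, mul_comm] at this
    have hd1 : dist x (c i) ≤ 1 := hdist.trans (min_le_left _ _)
    have hdρ : dist x (c i) < ρ := hdist.trans_lt ((min_le_right _ _).trans_lt (by linarith))
    have h3 : ENNReal.ofReal |g x - g (c i)| ≤ K.indicator (fun _ ↦ ENNReal.ofReal η) x := by
      by_cases hxK : x ∈ K
      · rw [indicator_of_mem hxK]
        exact ENNReal.ofReal_le_ofReal (hρg hdρ).le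
      · have hx0 : g x = 0 := image_eq_zero_of_notMem_tsupport fun hx' ↦
          hxK (Metric.self_subset_cthickening _ hx')
        have hc0 : g (c i) = 0 := image_eq_zero_of_notMem_tsupport fun hc' ↦
          hxK (Metric.mem_cthickening_of_dist_le _ _ _ _ hc' hd1)
        simp [hx0, hc0]
    calc ENNReal.ofReal |f x - g (c i)|
        ≤ ENNReal.ofReal (|f x - g x| + |g x - g (c i)|) := by
          refine ENNReal.ofReal_le_ofReal (abs_sub_le _ _ _)
      _ = ‖f x - g x‖ₑ + ENNReal.ofReal |g x - g (c i)| := by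
          rw [ENNReal.ofReal_add (abs_nonneg _) (abs_nonneg _), ← Real.enorm_eq_ofReal_abs]
      _ ≤ h x := by
          exact add_le_add_right h3 _
  calc ∑' i, ∫⁻ x in B i, ENNReal.ofReal |f x - g (c i)|
      ≤ ∑' i, ∫⁻ x in B i, h x :=
        ENNReal.tsum_le_tsum fun i ↦ setLIntegral_mono' (hBm i) (hpt i)
    _ = ∫⁻ x in ⋃ i, B i, h x := (lintegral_iUnion hBm hBd _).symm
    _ ≤ ∫⁻ x, h x := setLIntegral_le_lintegral _ _
    _ = (∫⁻ x, ‖f x - g x‖ₑ) + ENNReal.ofReal η * volume K := by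
        rw [hh, lintegral_add_right _ (measurable_const.indicator hKc.measurableSet),
          lintegral_indicator_const hKc.measurableSet]
    _ ≤ ENNReal.ofReal (δ / 2) + ENNReal.ofReal (δ / 2) := by
        gcongr
        rw [← ENNReal.ofReal_toReal hKfin, ← ENNReal.ofReal_mul hη0.le]
        refine ENNReal.ofReal_le_ofReal ?_
        rw [← hv, hη]
        field_simp
        linarith
    _ = ENNReal.ofReal δ := by
        rw [← ENNReal.ofReal_add (by positivity) (by positivity), add_halves]

lemma setLIntegral_mul_volume_rpow_le (hN : IsNorm N) (hd : 0 < d) {r : ℝ} (hr : 0 < r)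
    {f : (Fin d → ℝ) → ℝ} (hfm : Measurable f) {a : ℝ} {ε : ℝ} (hε : 0 < ε)
    {c : Fin d → ℝ} {B : Set (Fin d → ℝ)} (hBm : MeasurableSet B)
    (hB : ∀ x ∈ B, N (x - c) ≤ ε) :
    (∫⁻ x in B, ENNReal.ofReal (f x)) * ENNReal.ofReal ((volume B).toReal ^ (r / (d : ℝ))) ≤
      ENNReal.ofReal (unitBallVol N ^ (r / (d : ℝ)) * (1 + r / d)) *
        (∫⁻ x in B, ENNReal.ofReal (f x) * ENNReal.ofReal (N (x - c) ^ r)) +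
      ENNReal.ofReal ((unitBallVol N ^ (r / (d : ℝ)) * (1 + r / d) +
        unitBallVol N ^ (r / (d : ℝ))) * ε ^ r) *
        ∫⁻ x in B, ENNReal.ofReal |f x - a| := by
  have hd' : (0 : ℝ) < d := by exact_mod_cast hd
  have hV := hN.unitBallVol_pos
  have hp0 : 0 < r / (d : ℝ) := by positivity
  have hle : volume B ≤ ENNReal.ofReal (unitBallVol N * ε ^ d) :=
    (measure_mono hB).trans_eq (hN.volume_ball c hε)
  have hBfin : volume B ≠ ∞ := (hle.trans_lt ENNReal.ofReal_lt_top).ne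
  have hΛ : (volume B).toReal ^ (r / (d : ℝ)) ≤ unitBallVol N ^ (r / (d : ℝ)) * ε ^ r := by
    calc (volume B).toReal ^ (r / (d : ℝ)) ≤ (unitBallVol N * ε ^ d) ^ (r / (d : ℝ)) :=
          Real.rpow_le_rpow ENNReal.toReal_nonneg
            (ENNReal.toReal_le_of_le_ofReal (by positivity) hle) hp0.le
      _ = unitBallVol N ^ (r / (d : ℝ)) * ε ^ r := by
          rw [Real.mul_rpow hV.le (by positivity), ← Real.rpow_natCast ε d,
            ← Real.rpow_mul hε.le, mul_div_cancel₀ _ hd'.ne']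
  have hmom := hN.volume_mul_rpow_le_lintegral hd hr c hBfin
  set W := unitBallVol N ^ (r / (d : ℝ)) with hW
  have hW0 : 0 ≤ W := by positivity
  set C := W * (1 + r / d) with hC
  have hC0 : 0 ≤ C := by positivity
  set L := ENNReal.ofReal ((volume B).toReal ^ (r / (d : ℝ))) with hL
  set e := ∫⁻ x in B, ENNReal.ofReal |f x - a| with he
  have hem : Measurable fun x ↦ ENNReal.ofReal |f x - a| := by fun_prop
  have hNm : Measurable fun x ↦ ENNReal.ofReal (N (x - c) ^ r) :=
    ((hN.continuous.measurable.comp (measurable_id.sub_const c)).pow_const r).ennreal_ofReal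
  have h1 : ∫⁻ x in B, ENNReal.ofReal (f x) ≤ ENNReal.ofReal a * volume B + e := by
    rw [← setLIntegral_const, ← lintegral_add_right _ hem]
    refine lintegral_mono fun x ↦ ?_
    refine le_trans (ENNReal.ofReal_le_ofReal ?_) ENNReal.ofReal_add_le
    linarith [le_abs_self (f x - a)]
  have h2 : ENNReal.ofReal a * ∫⁻ x in B, ENNReal.ofReal (N (x - c) ^ r) ≤
      (∫⁻ x in B, ENNReal.ofReal (f x) * ENNReal.ofReal (N (x - c) ^ r)) +
        ENNReal.ofReal (ε ^ r) * e := by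
    rw [he, ← lintegral_const_mul _ hNm, ← lintegral_const_mul _ hem,
      ← lintegral_add_right _ (hem.const_mul _)]
    refine setLIntegral_mono' hBm fun x hx ↦ ?_
    calc ENNReal.ofReal a * ENNReal.ofReal (N (x - c) ^ r)
        ≤ (ENNReal.ofReal (f x) + ENNReal.ofReal |f x - a|) *
            ENNReal.ofReal (N (x - c) ^ r) := by
          gcongr
          refine le_trans (ENNReal.ofReal_le_ofReal ?_) ENNReal.ofReal_add_le
          linarith [neg_abs_le (f x - a)]
      _ ≤ _ := by
          rw [add_mul, mul_comm (ENNReal.ofReal |f x - a|)]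
          gcongr
          · exact hN.nonneg _
          · exact hB x hx
  calc (∫⁻ x in B, ENNReal.ofReal (f x)) * L
      ≤ (ENNReal.ofReal a * volume B + e) * L := by gcongr
    _ = ENNReal.ofReal a * (volume B * L) + L * e := by ring
    _ ≤ ENNReal.ofReal a * (ENNReal.ofReal C * ∫⁻ x in B, ENNReal.ofReal (N (x - c) ^ r)) +
          ENNReal.ofReal (W * ε ^ r) * e := by
        gcongr
        exact ENNReal.ofReal_le_ofReal hΛ
    _ = ENNReal.ofReal C * (ENNReal.ofReal a * ∫⁻ x in B, ENNReal.ofReal (N (x - c) ^ r)) +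
          ENNReal.ofReal (W * ε ^ r) * e := by ring
    _ ≤ ENNReal.ofReal C * ((∫⁻ x in B, ENNReal.ofReal (f x) * ENNReal.ofReal (N (x - c) ^ r)) +
          ENNReal.ofReal (ε ^ r) * e) + ENNReal.ofReal (W * ε ^ r) * e := by gcongr
    _ = _ := by
        have hε' : 0 ≤ ε ^ r := by positivity
        rw [add_mul C W, ENNReal.ofReal_add (by positivity) (by positivity),
          ENNReal.ofReal_mul hC0]
        ring

end IsNorm

/-- Lemma 4: with `ε = (D/κ)^{1/r}`,
`limsup_{D↓0} sup_q ∑ᵢ P(X ∈ B_{i,ε}) Λ_{i,ε}^{r/d} / D ≤ V_d^{r/d} (1 + r/d)`. -/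
theorem limsup_sup_sum_cell_measures_le {d : ℕ} (hd : 0 < d) {r : ℝ} (hr : 0 < r)
    {N : (Fin d → ℝ) → ℝ} (hN : IsNorm N)
    (μ : Measure (Fin d → ℝ)) [IsProbabilityMeasure μ]
    (f : (Fin d → ℝ) → ℝ) (hfm : Measurable f) (hf0 : ∀ x, 0 ≤ f x)
    (hμf : μ = volume.withDensity fun x => ENNReal.ofReal (f x))
    (κ : ℝ) (hκ : 0 < κ) :
    Filter.limsup (fun D =>
        ⨆ (q : Quantizer (Fin d → ℝ)) (_ : q.distortion μ N r ≤ ENNReal.ofReal D),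
          ∑' i : ℤ, μ (Bcell q N ((D / κ) ^ (1 / r)) i) *
            ENNReal.ofReal
              ((volume (Bcell q N ((D / κ) ^ (1 / r)) i)).toReal ^ (r / (d : ℝ)) / D))
      (𝓝[>] (0:ℝ))
      ≤ ENNReal.ofReal (unitBallVol N ^ (r / (d : ℝ)) * (1 + r / (d : ℝ))) := by
  have hd' : (0 : ℝ) < d := by exact_mod_cast hd
  have hV := hN.unitBallVol_pos
  have hfi : Integrable f volume := by
    refine ⟨hfm.aestronglyMeasurable, ?_⟩
    rw [hasFiniteIntegral_iff_ofReal (ae_of_all _ hf0), ← setLIntegral_univ,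
      ← withDensity_apply _ MeasurableSet.univ, ← hμf]
    exact measure_lt_top μ univ
  set W := unitBallVol N ^ (r / (d : ℝ)) with hW
  have hW0 : 0 < W := by positivity
  set C := W * (1 + r / (d : ℝ)) with hC
  have hC0 : 0 < C := by positivity
  refine ENNReal.le_of_forall_pos_le_add fun α hα _ ↦ ?_
  have hα' : (0 : ℝ) < α := hα
  obtain ⟨ε₀, hε₀, a, hcell⟩ := hN.exists_tsum_lintegral_sub_le hfi
    (δ := α * κ / (C + W)) (by positivity)
  have hsmall : ∀ᶠ D in 𝓝[>] (0 : ℝ), (D / κ) ^ (1 / r) ≤ ε₀ := by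
    have hcont : Tendsto (fun D : ℝ ↦ (D / κ) ^ (1 / r)) (𝓝 0) (𝓝 0) := by
      have h := ((Real.continuous_rpow_const (q := 1 / r) (by positivity)).comp
        (continuous_id.div_const κ)).tendsto 0
      simpa [Function.comp_def, Real.zero_rpow (inv_pos.2 hr).ne'] using h
    exact nhdsWithin_le_nhds (hcont.eventually_le_const hε₀)
  refine limsup_le_of_le (by isBoundedDefault) ?_
  filter_upwards [hsmall, self_mem_nhdsWithin] with D hDε hD
  have hD0 : 0 < D := hD
  refine iSup₂_le fun q hq ↦ ?_
  set ε := (D / κ) ^ (1 / r) with hε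
  have hε0 : 0 < ε := by positivity
  have hεr : ε ^ r = D / κ := by
    rw [hε, ← Real.rpow_mul (by positivity), one_div_mul_cancel hr.ne', Real.rpow_one]
  have hNm (c : Fin d → ℝ) : Measurable fun x ↦ N (x - c) :=
    hN.continuous.measurable.comp (measurable_id.sub_const c)
  have hBm (i : ℤ) : MeasurableSet (Bcell q N ε i) :=
    (q.meas i).inter (measurableSet_le (hNm _) measurable_const)
  have hBS (i : ℤ) : Bcell q N ε i ⊆ q.S i := fun x hx ↦ hx.1
  have hBd : Pairwise (Function.onFun Disjoint (Bcell q N ε)) := fun i j hij ↦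
    (q.disj hij).mono (hBS i) (hBS j)
  have herr := hcell (Bcell q N ε) q.c hBm hBd fun i x hx ↦ hx.2.trans hDε
  have hdist : ∑' i, ∫⁻ x in Bcell q N ε i,
      ENNReal.ofReal (f x) * ENNReal.ofReal (N (x - q.c i) ^ r) ≤ ENNReal.ofReal D := by
    refine le_trans (ENNReal.tsum_le_tsum fun i ↦ ?_) hq
    rw [hμf, setLIntegral_withDensity_eq_setLIntegral_mul _ hfm.ennreal_ofReal
      ((hNm _).pow_const r).ennreal_ofReal (q.meas i)]
    exact lintegral_mono_set (hBS i)
  calc ∑' i, μ (Bcell q N ε i) *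
        ENNReal.ofReal ((volume (Bcell q N ε i)).toReal ^ (r / (d : ℝ)) / D)
      ≤ ∑' i, (ENNReal.ofReal C * (∫⁻ x in Bcell q N ε i,
          ENNReal.ofReal (f x) * ENNReal.ofReal (N (x - q.c i) ^ r)) +
        ENNReal.ofReal ((C + W) * ε ^ r) *
          ∫⁻ x in Bcell q N ε i, ENNReal.ofReal |f x - a (q.c i)|) * ENNReal.ofReal D⁻¹ := by
        refine ENNReal.tsum_le_tsum fun i ↦ ?_
        rw [div_eq_mul_inv, ENNReal.ofReal_mul (by positivity), ← mul_assoc]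
        gcongr
        rw [hμf, withDensity_apply _ (hBm i)]
        exact hN.setLIntegral_mul_volume_rpow_le hd hr hfm hε0 (hBm i) fun x hx ↦ hx.2
    _ = (ENNReal.ofReal C * (∑' i, ∫⁻ x in Bcell q N ε i,
          ENNReal.ofReal (f x) * ENNReal.ofReal (N (x - q.c i) ^ r)) +
        ENNReal.ofReal ((C + W) * ε ^ r) *
          ∑' i, ∫⁻ x in Bcell q N ε i, ENNReal.ofReal |f x - a (q.c i)|) *
            ENNReal.ofReal D⁻¹ := by
        rw [ENNReal.tsum_mul_right, ENNReal.tsum_add, ENNReal.tsum_mul_left, ENNReal.tsum_mul_left]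
    _ ≤ (ENNReal.ofReal C * ENNReal.ofReal D +
        ENNReal.ofReal ((C + W) * ε ^ r) * ENNReal.ofReal (α * κ / (C + W))) *
          ENNReal.ofReal D⁻¹ := by gcongr
    _ = ENNReal.ofReal C + α := by
        rw [← ENNReal.ofReal_mul hC0.le, ← ENNReal.ofReal_mul (by positivity),
          ← ENNReal.ofReal_add (by positivity) (by positivity),
          ← ENNReal.ofReal_mul (by positivity), ← ENNReal.ofReal_coe_nnreal (p := α),
          ← ENNReal.ofReal_add hC0.le hα'.le, hεr]
        congr 1
        field_simp

end
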